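/- arXiv:2104.03348 — 2 statements merged into one kernel-verified Lean document; each statement's English description precedes it below -/
import Mathlib

section
/- Given finitely many points x₁ < ⋯ < xₙ in [0, 2π) and real numbers 0 ≤ y₁ < ⋯ < yₙ < y₁ + 2π, there exists a real-analytic function f : ℝ → ℝ such that f′(x) > 0 for all x ∈ ℝ, f(x) − x is 2π-periodic, and for all j ∈ {1,…,n}: (1) f(x_j) = y_j; (2) f′(x_j) = 1; (3) if y_{j+1} − y_j > x_{j+1} − x_j, then f′(x) > 1 for every x ∈ (x_j, x_{j+1}) + 2πℤ; (4) if y_{j+1} − y_j < x_{j+1} − x_j, then f′(x) < 1 for every x ∈ (x_j, x_{j+1}) + 2πℤ; here x_{n+1} := x₁ + 2π and y_{n+1} := y₁ + 2π. -/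
noncomputable section

open Filter Topology in
/-- A function whose derivative is analytic at a point is itself analytic there. -/
theorem analyticAt_of_eventually_hasDerivAt {f F : ℝ → ℝ} {x : ℝ}
    (h : ∀ᶠ t in 𝓝 x, HasDerivAt f (F t) t) (hF : AnalyticAt ℝ F x) : AnalyticAt ℝ f x := by
  obtain ⟨p, hp⟩ := hF
  obtain ⟨r, hr⟩ := hp
  obtain ⟨r', hr'0, hr'⟩ := ENNReal.lt_iff_exists_nnreal_btwn.1 (hr.r_pos.trans_le hr.r_le)
  obtain ⟨C, hC0, hC⟩ := p.norm_mul_pow_le_of_lt_radius hr'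
  set c : ℕ → ℝ := fun n => p.coeff (n - 1) / n with hc
  set q := FormalMultilinearSeries.ofScalars ℝ c with hq
  have hqr : (r' : ENNReal) ≤ q.radius := by
    refine q.le_radius_of_bound (C * r') fun n => ?_
    rcases n with _ | n
    · simp [hq, hc]; positivity
    · rw [FormalMultilinearSeries.norm_apply_eq_norm_coef, hq,
        FormalMultilinearSeries.coeff_ofScalars, pow_succ, ← mul_assoc]
      refine mul_le_mul_of_nonneg_right (le_trans ?_ (hC n)) r'.2
      rw [FormalMultilinearSeries.norm_apply_eq_norm_coef]
      refine mul_le_mul_of_nonneg_right ?_ (by positivity)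
      simp only [hc, Nat.add_sub_cancel, norm_div, Real.norm_natCast]
      exact div_le_self (norm_nonneg _) (by push_cast; linarith [(Nat.cast_nonneg n : (0:ℝ) ≤ n)])
  have hG0 : HasFPowerSeriesOnBall q.sum q 0 q.radius :=
    q.hasFPowerSeriesOnBall (hr'0.trans_le hqr)
  have hG : HasFPowerSeriesAt (fun t => q.sum (t - x)) q x := by
    have := hG0.comp_sub x
    rw [zero_add] at this
    exact this.hasFPowerSeriesAt
  have hd : ∀ᶠ t in 𝓝 x, HasDerivAt (fun t => q.sum (t - x)) (F t) t := by
    obtain ⟨s, hs⟩ := hG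
    have hs' := hs.fderiv
    have h1 : ∀ᶠ t in 𝓝 x, t ∈ Metric.eball x (min r s) :=
      Metric.eball_mem_nhds _ (lt_min hr.r_pos hs.r_pos)
    filter_upwards [h1] with t ht
    have htr : t ∈ Metric.eball x r := Metric.eball_subset_eball (min_le_left _ _) ht
    have hts : t ∈ Metric.eball x s := Metric.eball_subset_eball (min_le_right _ _) ht
    have e1 := hr.hasSum_sub htr
    have e2 := (hs'.hasSum_sub hts).mapL (ContinuousLinearMap.apply ℝ ℝ (1 : ℝ))
    have e3 : fderiv ℝ (fun t => q.sum (t - x)) t 1 = F t := by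
      refine e2.unique ?_
      convert e1 using 2 with n
      simp only [FormalMultilinearSeries.apply_eq_pow_smul_coeff, map_smul,
        ContinuousLinearMap.apply_apply, FormalMultilinearSeries.derivSeries_coeff_one, hq,
        FormalMultilinearSeries.coeff_ofScalars]
      simp only [hc, Nat.add_sub_cancel, nsmul_eq_mul, smul_eq_mul]
      have : (n : ℝ) + 1 ≠ 0 := by positivity
      push_cast
      field_simp
    have hda : DifferentiableAt ℝ (fun t => q.sum (t - x)) t :=
      (hs.analyticAt_of_mem hts).differentiableAt
    have := hda.hasDerivAt
    rwa [← fderiv_apply_one_eq_deriv, e3] at this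
  obtain ⟨ε, hε, hball⟩ := Metric.eventually_nhds_iff_ball.1 (h.and hd)
  have hconst : ∀ t ∈ Metric.ball x ε, f t = q.sum (t - x) + (f x - q.sum (x - x)) := by
    intro t ht
    have := (convex_ball x ε).is_const_of_fderivWithin_eq_zero (𝕜 := ℝ)
      (f := fun t => f t - q.sum (t - x))
      (fun s hs => ((hball s hs).1.sub (hball s hs).2).differentiableAt.differentiableWithinAt)
      (fun s hs => by
        rw [fderivWithin_of_isOpen Metric.isOpen_ball hs]
        have := ((hball s hs).1.sub (hball s hs).2).hasFDerivAt.fderiv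
        rw [sub_self] at this
        refine this.trans ?_
        ext; simp)
      ht (Metric.mem_ball_self hε)
    linarith
  refine (hG.analyticAt.add (analyticAt_const (v := f x - q.sum (x - x)))).congr ?_
  filter_upwards [Metric.ball_mem_nhds x hε] with t ht
  exact (hconst t ht).symm

open Topology in
/-- In finite dimension, a convex set contains every interior point of its closure. -/
theorem Convex.mem_of_closure_mem_nhds {E : Type*} [NormedAddCommGroup E] [NormedSpace ℝ E]
    [FiniteDimensional ℝ E] {s : Set E} (hs : Convex ℝ s) {x : E} (h : closure s ∈ 𝓝 x) :
    x ∈ s := by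
  have hx : x ∈ interior (closure s) := mem_interior_iff_mem_nhds.2 h
  have hcl : closure s ⊆ affineSpan ℝ s :=
    closure_minimal (subset_affineSpan ℝ s) (affineSpan ℝ s).closed_of_finiteDimensional
  have htop : affineSpan ℝ s = ⊤ := by
    have h1 : affineSpan ℝ (closure s) = ⊤ :=
      hs.closure.interior_nonempty_iff_affineSpan_eq_top.1 ⟨x, hx⟩
    exact top_le_iff.1 (h1 ▸ affineSpan_le.2 hcl)
  rw [hs.interior_closure_eq_interior_of_nonempty_interior
    (hs.interior_nonempty_iff_affineSpan_eq_top.2 htop)] at hx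
  exact interior_subset hx

/-- A `2π`-periodic analytic function that vanishes at `a` and `b`, is positive on the arc from
`a` to `b` and negative on the complementary arc. -/
def arcFun (a b t : ℝ) : ℝ := Real.cos (t - (a + b) / 2) - Real.cos ((b - a) / 2)

theorem arcFun_eq (a b t : ℝ) :
    arcFun a b t = 2 * (Real.sin ((t - a) / 2) * Real.sin ((b - t) / 2)) := by
  rw [arcFun, Real.cos_sub_cos,
    show (t - (a + b) / 2 + (b - a) / 2) / 2 = (t - a) / 2 by ring,
    show (t - (a + b) / 2 - (b - a) / 2) / 2 = -((b - t) / 2) by ring, Real.sin_neg]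
  ring

theorem arcFun_add_two_pi (a b t : ℝ) : arcFun a b (t + 2 * Real.pi) = arcFun a b t := by
  rw [arcFun, arcFun, show t + 2 * Real.pi - (a + b) / 2 = t - (a + b) / 2 + 2 * Real.pi by ring,
    Real.cos_add_two_pi]

theorem arcFun_left (a b : ℝ) : arcFun a b a = 0 := by simp [arcFun_eq]

theorem arcFun_pos {a b t : ℝ} (hab : b ≤ a + 2 * Real.pi) (hat : a < t) (htb : t < b) :
    0 < arcFun a b t := by
  rw [arcFun_eq]
  have h1 := Real.sin_pos_of_pos_of_lt_pi (x := (t - a) / 2) (by linarith) (by linarith)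
  have h2 := Real.sin_pos_of_pos_of_lt_pi (x := (b - t) / 2) (by linarith) (by linarith)
  positivity

theorem arcFun_neg {a b t : ℝ} (hab : a < b) (hbt : b < t) (hta : t < a + 2 * Real.pi) :
    arcFun a b t < 0 := by
  rw [arcFun_eq]
  have h1 := Real.sin_pos_of_pos_of_lt_pi (x := (t - a) / 2) (by linarith) (by linarith)
  have h2 := Real.sin_neg_of_neg_of_neg_pi_lt (x := (b - t) / 2) (by linarith) (by linarith)
  nlinarith [mul_neg_of_pos_of_neg h1 h2]

@[fun_prop]
theorem contDiff_arcFun (a b : ℝ) {k : WithTop ℕ∞} : ContDiff ℝ k (arcFun a b) := by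
  unfold arcFun
  fun_prop

section Arcs

variable {n : ℕ} {x : Fin (n + 1) → ℝ}

theorem node_le_node_add (hxm : StrictMono x) (hxlast : x (Fin.last n) = x 0 + 2 * Real.pi)
    (i j : Fin (n + 1)) : x i ≤ x j + 2 * Real.pi := by
  have h1 := hxm.monotone (Fin.le_last i)
  have h2 := hxm.monotone (Fin.zero_le j)
  linarith

theorem arcFun_neg_of_ne (hxm : StrictMono x) (hxlast : x (Fin.last n) = x 0 + 2 * Real.pi)
    {j k : Fin n} (hjk : k ≠ j) {t : ℝ} (ht : t ∈ Set.Ioo (x j.castSucc) (x j.succ)) :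
    arcFun (x k.castSucc) (x k.succ) t < 0 := by
  have hk : x k.castSucc < x k.succ := hxm k.castSucc_lt_succ
  rcases lt_or_gt_of_ne hjk with h | h
  · refine arcFun_neg hk (lt_of_le_of_lt (hxm.monotone ?_) ht.1)
      (ht.2.trans_le (node_le_node_add hxm hxlast _ _))
    rw [Fin.le_def]
    simpa using Nat.succ_le_of_lt h
  · rw [← arcFun_add_two_pi]
    refine arcFun_neg hk ((node_le_node_add hxm hxlast _ j.castSucc).trans_lt
      (by linarith [ht.1])) ?_
    have : x j.succ ≤ x k.castSucc := hxm.monotone (by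
      rw [Fin.le_def]
      simpa using Nat.succ_le_of_lt h)
    linarith [ht.2]

theorem arcFun_pos_of_mem (hxm : StrictMono x) (hxlast : x (Fin.last n) = x 0 + 2 * Real.pi)
    {j : Fin n} {t : ℝ} (ht : t ∈ Set.Ioo (x j.castSucc) (x j.succ)) :
    0 < arcFun (x j.castSucc) (x j.succ) t :=
  arcFun_pos (node_le_node_add hxm hxlast _ _) ht.1 ht.2

/-- A `2π`-periodic analytic function vanishing at the nodes `x`, negative on the arcs whose
prescribed length `v j` is smaller than their actual length, and positive on the other arcs. -/
def arcSign (x : Fin (n + 1) → ℝ) (v : Fin n → ℝ) (t : ℝ) : ℝ :=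
  ∏ k : Fin n, if v k < x k.succ - x k.castSucc then -arcFun (x k.castSucc) (x k.succ) t ^ 3
    else arcFun (x k.castSucc) (x k.succ) t ^ 2

theorem contDiff_arcSign (x : Fin (n + 1) → ℝ) (v : Fin n → ℝ) {m : WithTop ℕ∞} :
    ContDiff ℝ m (arcSign x v) := by
  unfold arcSign
  refine contDiff_prod fun k _ => ?_
  split_ifs <;> fun_prop

theorem arcSign_add_two_pi (x : Fin (n + 1) → ℝ) (v : Fin n → ℝ) (t : ℝ) :
    arcSign x v (t + 2 * Real.pi) = arcSign x v t := by
  simp only [arcSign, arcFun_add_two_pi]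

theorem arcSign_node (x : Fin (n + 1) → ℝ) (v : Fin n → ℝ) (j : Fin n) :
    arcSign x v (x j.castSucc) = 0 :=
  Finset.prod_eq_zero (Finset.mem_univ j) (by simp [arcFun_left])

theorem arcSign_eq_mul (hxm : StrictMono x) (hxlast : x (Fin.last n) = x 0 + 2 * Real.pi)
    (v : Fin n → ℝ) {j : Fin n} {t : ℝ} (ht : t ∈ Set.Ioo (x j.castSucc) (x j.succ)) :
    ∃ c > 0, arcSign x v t =
      if v j < x j.succ - x j.castSucc then -c else c := by
  have hj := arcFun_pos_of_mem hxm hxlast ht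
  have herase : 0 < ∏ k ∈ Finset.univ.erase j,
      if v k < x k.succ - x k.castSucc then -arcFun (x k.castSucc) (x k.succ) t ^ 3
        else arcFun (x k.castSucc) (x k.succ) t ^ 2 := by
    refine Finset.prod_pos fun k hk => ?_
    have hneg := arcFun_neg_of_ne hxm hxlast (Finset.ne_of_mem_erase hk) ht
    split_ifs
    · exact neg_pos.2 (Odd.pow_neg (by decide) hneg)
    · exact sq_pos_of_neg hneg
  rw [arcSign, ← Finset.mul_prod_erase _ _ (Finset.mem_univ j)]
  split_ifs with h
  · exact ⟨_, mul_pos (pow_pos hj 3) herase, by ring⟩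
  · exact ⟨_, mul_pos (pow_pos hj 2) herase, rfl⟩

/-- `F` is an admissible derivative for an interpolant with nodes `x` that stretches the `j`-th
arc to length `w j`. -/
structure IsSlope (x : Fin (n + 1) → ℝ) (w : Fin n → ℝ) (F : ℝ → ℝ) : Prop where
  contDiff : ContDiff ℝ ⊤ F
  pos : ∀ t, 0 < F t
  periodic : Function.Periodic F (2 * Real.pi)
  node : ∀ j : Fin n, F (x j.castSucc) = 1
  one_lt : ∀ j : Fin n, x j.succ - x j.castSucc < w j →
    ∀ t ∈ Set.Ioo (x j.castSucc) (x j.succ), 1 < F t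
  lt_one : ∀ j : Fin n, w j < x j.succ - x j.castSucc →
    ∀ t ∈ Set.Ioo (x j.castSucc) (x j.succ), F t < 1

/-- The tuples of arc integrals attained by admissible slopes. -/
def slopeIntegrals (x : Fin (n + 1) → ℝ) (w : Fin n → ℝ) : Set (Fin n → ℝ) :=
  {v | ∃ F, IsSlope x w F ∧ ∀ j, ∫ t in x j.castSucc..x j.succ, F t = v j}

theorem convex_slopeIntegrals (x : Fin (n + 1) → ℝ) (w : Fin n → ℝ) :
    Convex ℝ (slopeIntegrals x w) := by
  rw [convex_iff_forall_pos]
  rintro v ⟨F, hF, hFv⟩ v' ⟨G, hG, hGv⟩ a b ha hb hab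
  refine ⟨fun t => a * F t + b * G t, ⟨?_, fun t => ?_, fun t => ?_, fun j => ?_,
    fun j hj t ht => ?_, fun j hj t ht => ?_⟩, fun j => ?_⟩
  · exact (contDiff_const.mul hF.contDiff).add (contDiff_const.mul hG.contDiff)
  · have := hF.pos t
    have := hG.pos t
    positivity
  · simp only [hF.periodic t, hG.periodic t]
  · simp only [hF.node j, hG.node j, mul_one, hab]
  · nlinarith [hF.one_lt j hj t ht, hG.one_lt j hj t ht]
  · nlinarith [hF.lt_one j hj t ht, hG.lt_one j hj t ht]
  · rw [intervalIntegral.integral_add, intervalIntegral.integral_const_mul,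
      intervalIntegral.integral_const_mul, hFv, hGv]
    · rfl
    · exact (continuous_const.mul hF.contDiff.continuous).intervalIntegrable _ _
    · exact (continuous_const.mul hG.contDiff.continuous).intervalIntegrable _ _

/-- Logarithms of slopes, converging as `N → ∞` to the logarithm of the piecewise constant slope
that stretches the `j`-th arc to length `v j`. -/
def logSlope (x : Fin (n + 1) → ℝ) (v : Fin n → ℝ) (N t : ℝ) : ℝ :=
  ∑ k : Fin n, |Real.log (v k / (x k.succ - x k.castSucc))| * (2 / Real.pi) *
    Real.arctan (arcSign x v t * Real.exp (N * arcFun (x k.castSucc) (x k.succ) t))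

theorem contDiff_logSlope (x : Fin (n + 1) → ℝ) (v : Fin n → ℝ) (N : ℝ) {m : WithTop ℕ∞} :
    ContDiff ℝ m (logSlope x v N) := by
  unfold logSlope
  refine ContDiff.sum fun k _ => contDiff_const.mul (Real.contDiff_arctan.comp ?_)
  exact (contDiff_arcSign x v).mul (contDiff_const.mul (contDiff_arcFun _ _)).exp

theorem logSlope_le (x : Fin (n + 1) → ℝ) (v : Fin n → ℝ) (N t : ℝ) :
    logSlope x v N t ≤ ∑ k : Fin n, |Real.log (v k / (x k.succ - x k.castSucc))| := by
  refine Finset.sum_le_sum fun k _ => ?_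
  have h := (Real.arctan_lt_pi_div_two
    (arcSign x v t * Real.exp (N * arcFun (x k.castSucc) (x k.succ) t))).le
  calc _ ≤ |Real.log (v k / (x k.succ - x k.castSucc))| * (2 / Real.pi) * (Real.pi / 2) := by
        have := Real.pi_pos
        gcongr
    _ = _ := by
        have := Real.pi_ne_zero
        field_simp

theorem logSlope_pos (hxm : StrictMono x) (hxlast : x (Fin.last n) = x 0 + 2 * Real.pi)
    {v : Fin n → ℝ} {j : Fin n} (hj : x j.succ - x j.castSucc < v j) (N : ℝ) {t : ℝ}
    (ht : t ∈ Set.Ioo (x j.castSucc) (x j.succ)) : 0 < logSlope x v N t := by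
  obtain ⟨c, hc, hct⟩ := arcSign_eq_mul hxm hxlast v ht
  rw [if_neg hj.not_gt] at hct
  have hpi := Real.pi_pos
  have harc : ∀ k : Fin n, 0 < Real.arctan
      (arcSign x v t * Real.exp (N * arcFun (x k.castSucc) (x k.succ) t)) := fun k =>
    Real.arctan_pos.2 (by rw [hct]; positivity)
  refine Finset.sum_pos' (fun k _ => ?_) ⟨j, Finset.mem_univ j, ?_⟩
  · have := harc k
    positivity
  · have hl : 0 < x j.succ - x j.castSucc := sub_pos.2 (hxm j.castSucc_lt_succ)
    have hlog : 0 < |Real.log (v j / (x j.succ - x j.castSucc))| :=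
      abs_pos.2 (Real.log_pos ((one_lt_div hl).2 hj)).ne'
    have := harc j
    positivity

theorem logSlope_neg (hxm : StrictMono x) (hxlast : x (Fin.last n) = x 0 + 2 * Real.pi)
    {v : Fin n → ℝ} (hv : ∀ k, 0 < v k) {j : Fin n} (hj : v j < x j.succ - x j.castSucc)
    (N : ℝ) {t : ℝ} (ht : t ∈ Set.Ioo (x j.castSucc) (x j.succ)) : logSlope x v N t < 0 := by
  obtain ⟨c, hc, hct⟩ := arcSign_eq_mul hxm hxlast v ht
  rw [if_pos hj] at hct
  have hpi := Real.pi_pos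
  have harc : ∀ k : Fin n, Real.arctan
      (arcSign x v t * Real.exp (N * arcFun (x k.castSucc) (x k.succ) t)) < 0 := fun k =>
    Real.arctan_lt_zero.2 (by
      rw [hct]
      exact mul_neg_of_neg_of_pos (neg_lt_zero.2 hc) (Real.exp_pos _))
  refine Finset.sum_neg' (fun k _ => ?_) ⟨j, Finset.mem_univ j, ?_⟩
  · exact mul_nonpos_of_nonneg_of_nonpos (by positivity) (harc k).le
  · have hl : 0 < x j.succ - x j.castSucc := sub_pos.2 (hxm j.castSucc_lt_succ)
    have hlog : 0 < |Real.log (v j / (x j.succ - x j.castSucc))| :=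
      abs_pos.2 (Real.log_neg (div_pos (hv j) hl) ((div_lt_one hl).2 hj)).ne
    exact mul_neg_of_pos_of_neg (by positivity) (harc j)

open Filter Topology in
theorem tendsto_logSlope (hxm : StrictMono x) (hxlast : x (Fin.last n) = x 0 + 2 * Real.pi)
    {v : Fin n → ℝ} (hv : ∀ k, 0 < v k) {j : Fin n} {t : ℝ}
    (ht : t ∈ Set.Ioo (x j.castSucc) (x j.succ)) :
    Tendsto (fun N => logSlope x v N t) atTop
      (𝓝 (Real.log (v j / (x j.succ - x j.castSucc)))) := by
  have hl : 0 < x j.succ - x j.castSucc := sub_pos.2 (hxm j.castSucc_lt_succ)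
  have hpi := Real.pi_ne_zero
  have hoff : ∀ k, k ≠ j → Tendsto (fun N => |Real.log (v k / (x k.succ - x k.castSucc))| *
      (2 / Real.pi) * Real.arctan
        (arcSign x v t * Real.exp (N * arcFun (x k.castSucc) (x k.succ) t))) atTop (𝓝 0) := by
    intro k hk
    have h1 : Tendsto (fun N : ℝ => N * arcFun (x k.castSucc) (x k.succ) t) atTop atBot :=
      tendsto_id.atTop_mul_const_of_neg (arcFun_neg_of_ne hxm hxlast hk ht)
    have h2 := (Real.tendsto_exp_atBot.comp h1).const_mul (arcSign x v t)
    rw [mul_zero] at h2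
    have h3 := ((Real.continuous_arctan.tendsto 0).comp h2).const_mul
      (|Real.log (v k / (x k.succ - x k.castSucc))| * (2 / Real.pi))
    simpa using h3
  have hexp : Tendsto (fun N : ℝ => Real.exp (N * arcFun (x j.castSucc) (x j.succ) t))
      atTop atTop :=
    Real.tendsto_exp_atTop.comp
      (tendsto_id.atTop_mul_const (arcFun_pos_of_mem hxm hxlast ht))
  have hon : Tendsto (fun N => |Real.log (v j / (x j.succ - x j.castSucc))| *
      (2 / Real.pi) * Real.arctan
        (arcSign x v t * Real.exp (N * arcFun (x j.castSucc) (x j.succ) t))) atTop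
      (𝓝 (Real.log (v j / (x j.succ - x j.castSucc)))) := by
    obtain ⟨c, hc, hct⟩ := arcSign_eq_mul hxm hxlast v ht
    split_ifs at hct with h
    · have h2 : Tendsto (fun N => Real.arctan
          (arcSign x v t * Real.exp (N * arcFun (x j.castSucc) (x j.succ) t))) atTop
          (𝓝 (-(Real.pi / 2))) :=
        (Real.tendsto_arctan_atBot.mono_right nhdsWithin_le_nhds).comp
          (hexp.const_mul_atTop_of_neg (by linarith))
      convert h2.const_mul (|Real.log (v j / (x j.succ - x j.castSucc))| * (2 / Real.pi)) using 2
      rw [abs_of_neg (Real.log_neg (div_pos (hv j) hl) ((div_lt_one hl).2 h))]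
      field_simp
    · have h2 : Tendsto (fun N => Real.arctan
          (arcSign x v t * Real.exp (N * arcFun (x j.castSucc) (x j.succ) t))) atTop
          (𝓝 (Real.pi / 2)) :=
        (Real.tendsto_arctan_atTop.mono_right nhdsWithin_le_nhds).comp
          (hexp.const_mul_atTop (by linarith))
      convert h2.const_mul (|Real.log (v j / (x j.succ - x j.castSucc))| * (2 / Real.pi)) using 2
      rw [abs_of_nonneg (Real.log_nonneg ((one_le_div hl).2 (not_lt.1 h)))]
      field_simp
  have := tendsto_finsetSum (Finset.univ : Finset (Fin n)) (x := atTop)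
    (f := fun k (N : ℝ) => |Real.log (v k / (x k.succ - x k.castSucc))| * (2 / Real.pi) *
      Real.arctan (arcSign x v t * Real.exp (N * arcFun (x k.castSucc) (x k.succ) t)))
    (a := fun k => if k = j then
      Real.log (v j / (x j.succ - x j.castSucc)) else 0) (fun k _ => by
    by_cases hk : k = j
    · subst hk
      simpa using hon
    · simpa [hk] using hoff k hk)
  simpa [logSlope] using this

theorem isSlope_exp_logSlope (hxm : StrictMono x)
    (hxlast : x (Fin.last n) = x 0 + 2 * Real.pi) {v w : Fin n → ℝ} (hv : ∀ k, 0 < v k)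
    (hgt : ∀ j, x j.succ - x j.castSucc < w j → x j.succ - x j.castSucc < v j)
    (hlt : ∀ j, w j < x j.succ - x j.castSucc → v j < x j.succ - x j.castSucc) (N : ℝ) :
    IsSlope x w fun t => Real.exp (logSlope x v N t) where
  contDiff := (contDiff_logSlope x v N).exp
  pos t := Real.exp_pos _
  periodic t := by simp only [logSlope, arcSign_add_two_pi, arcFun_add_two_pi]
  node j := by simp [logSlope, arcSign_node]
  one_lt j hj t ht := Real.one_lt_exp_iff.2 (logSlope_pos hxm hxlast (hgt j hj) N ht)
  lt_one j hj t ht := Real.exp_lt_one_iff.2 (logSlope_neg hxm hxlast hv (hlt j hj) N ht)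

open Filter Topology in
theorem mem_closure_slopeIntegrals (hxm : StrictMono x)
    (hxlast : x (Fin.last n) = x 0 + 2 * Real.pi) {v w : Fin n → ℝ} (hv : ∀ k, 0 < v k)
    (hgt : ∀ j, x j.succ - x j.castSucc < w j → x j.succ - x j.castSucc < v j)
    (hlt : ∀ j, w j < x j.succ - x j.castSucc → v j < x j.succ - x j.castSucc) :
    v ∈ closure (slopeIntegrals x w) := by
  refine mem_closure_of_tendsto (b := (atTop : Filter ℝ))
    (f := fun N j => ∫ t in x j.castSucc..x j.succ, Real.exp (logSlope x v N t))
    (tendsto_pi_nhds.2 fun j => ?_)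
    (Eventually.of_forall fun N => ⟨_, isSlope_exp_logSlope hxm hxlast hv hgt hlt N, fun _ => rfl⟩)
  have hl : 0 < x j.succ - x j.castSucc := sub_pos.2 (hxm j.castSucc_lt_succ)
  have hlim : ∫ _ in x j.castSucc..x j.succ,
      Real.exp (Real.log (v j / (x j.succ - x j.castSucc))) = v j := by
    rw [intervalIntegral.integral_const, Real.exp_log (div_pos (hv j) hl), smul_eq_mul]
    field_simp
  rw [← hlim]
  refine intervalIntegral.tendsto_integral_filter_of_dominated_convergence
    (fun _ => Real.exp (∑ k : Fin n, |Real.log (v k / (x k.succ - x k.castSucc))|))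
    (Eventually.of_forall fun N =>
      (contDiff_logSlope x v N (m := 0)).exp.continuous.aestronglyMeasurable)
    (Eventually.of_forall fun N => Eventually.of_forall fun t _ => ?_)
    intervalIntegrable_const ?_
  · rw [Real.norm_of_nonneg (Real.exp_pos _).le]
    exact Real.exp_le_exp.2 (logSlope_le x v N t)
  · filter_upwards [MeasureTheory.Measure.ae_ne MeasureTheory.volume (x j.succ)] with t hne ht
    rw [Set.uIoc_of_le (by linarith)] at ht
    exact (Real.continuous_exp.tendsto _).comp
      (tendsto_logSlope hxm hxlast hv ⟨ht.1, lt_of_le_of_ne ht.2 hne⟩)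

open Filter Topology in
theorem mem_slopeIntegrals (hxm : StrictMono x)
    (hxlast : x (Fin.last n) = x 0 + 2 * Real.pi) {w : Fin n → ℝ} (hw : ∀ k, 0 < w k) :
    w ∈ slopeIntegrals x w := by
  refine (convex_slopeIntegrals x w).mem_of_closure_mem_nhds ?_
  have hev : ∀ᶠ v in 𝓝 w, ∀ j, 0 < v j ∧
      (x j.succ - x j.castSucc < w j → x j.succ - x j.castSucc < v j) ∧
      (w j < x j.succ - x j.castSucc → v j < x j.succ - x j.castSucc) := by
    refine eventually_all.2 fun j => ?_
    have hc : Tendsto (fun v : Fin n → ℝ => v j) (𝓝 w) (𝓝 (w j)) :=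
      (continuous_apply j).tendsto w
    refine (hc.eventually_const_lt (hw j)).and (Eventually.and ?_ ?_)
    · exact eventually_imp_distrib_left.2 fun h => hc.eventually_const_lt h
    · exact eventually_imp_distrib_left.2 fun h => hc.eventually_lt_const h
  filter_upwards [hev] with v hv
  exact mem_closure_slopeIntegrals hxm hxlast (fun k => (hv k).1) (fun k => (hv k).2.1)
    fun k => (hv k).2.2

end Arcs

/-- **Lemma (real-analytic interpolation).** Given `x₁ < ⋯ < xₙ` in `[0, 2π)` and
`0 ≤ y₁ < ⋯ < yₙ < y₁ + 2π` (encoded here by extended tuples `x, y : Fin (n+1) → ℝ`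
with `x (last) = x 0 + 2π` and `y (last) = y 0 + 2π`), there is a real-analytic
`f : ℝ → ℝ` with `f' > 0`, `f(x) - x` being `2π`-periodic, interpolating the data
with derivative `1` at the nodes, and derivative `> 1` (resp. `< 1`) on the intervals
that are expanded (resp. contracted). -/
theorem analytic_interpolation
    (n : ℕ) (hn : 1 ≤ n) (x y : Fin (n + 1) → ℝ)
    (hxm : StrictMono x) (hym : StrictMono y)
    (hx0 : 0 ≤ x 0) (hxlt : ∀ i : Fin n, x i.castSucc < 2 * Real.pi)
    (hxlast : x (Fin.last n) = x 0 + 2 * Real.pi)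
    (hy0 : 0 ≤ y 0)
    (hylast : y (Fin.last n) = y 0 + 2 * Real.pi) :
    ∃ f : ℝ → ℝ,
      (∀ t : ℝ, AnalyticAt ℝ f t) ∧
      (∀ t : ℝ, 0 < deriv f t) ∧
      (∀ t : ℝ, f (t + 2 * Real.pi) = f t + 2 * Real.pi) ∧
      (∀ j : Fin n, f (x j.castSucc) = y j.castSucc) ∧
      (∀ j : Fin n, deriv f (x j.castSucc) = 1) ∧
      (∀ j : Fin n, x j.succ - x j.castSucc < y j.succ - y j.castSucc →
        ∀ t ∈ Set.Ioo (x j.castSucc) (x j.succ), ∀ m : ℤ,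
          1 < deriv f (t + 2 * Real.pi * m)) ∧
      (∀ j : Fin n, y j.succ - y j.castSucc < x j.succ - x j.castSucc →
        ∀ t ∈ Set.Ioo (x j.castSucc) (x j.succ), ∀ m : ℤ,
          deriv f (t + 2 * Real.pi * m) < 1) := by
  have hw : ∀ j : Fin n, 0 < y j.succ - y j.castSucc := fun j =>
    sub_pos.2 (hym j.castSucc_lt_succ)
  obtain ⟨F, hF, hFint⟩ := mem_slopeIntegrals (w := fun j => y j.succ - y j.castSucc) hxm hxlast hw
  have hcont : Continuous F := hF.contDiff.continuous
  have hII : ∀ a b, IntervalIntegrable F MeasureTheory.volume a b := fun a b =>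
    hcont.intervalIntegrable a b
  set f : ℝ → ℝ := fun t => y 0 + ∫ s in x 0..t, F s with hf
  have hderiv : ∀ t, HasDerivAt f (F t) t := fun t =>
    (hcont.integral_hasStrictDerivAt (x 0) t).hasDerivAt.const_add _
  have hd : deriv f = F := funext fun t => (hderiv t).deriv
  have hnode : ∀ i : Fin (n + 1), f (x i) = y i := by
    intro i
    induction i using Fin.induction with
    | zero => simp [hf]
    | succ j ih =>
      have := intervalIntegral.integral_add_adjacent_intervals
        (hII (x 0) (x j.castSucc)) (hII (x j.castSucc) (x j.succ))
      simp only [hf] at ih ⊢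
      linarith [hFint j]
  have hper : ∀ (t : ℝ) (m : ℤ), F (t + 2 * Real.pi * m) = F t := fun t m => by
    rw [mul_comm]
    exact hF.periodic.int_mul m t
  refine ⟨f, ?_⟩
  rw [hd]
  refine ⟨fun t => ?_, hF.pos, fun t => ?_, fun j => hnode _, hF.node,
    fun j hj t ht m => ?_, fun j hj t ht m => ?_⟩
  · exact analyticAt_of_eventually_hasDerivAt (Filter.Eventually.of_forall hderiv)
      (hF.contDiff.contDiffAt.analyticAt)
  · have h1 := intervalIntegral.integral_add_adjacent_intervals
      (hII (x 0) t) (hII t (t + 2 * Real.pi))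
    have h2 := hF.periodic.intervalIntegral_add_eq t (x 0)
    have h3 := hnode (Fin.last n)
    rw [hxlast, hylast] at h3
    simp only [hf] at h3 ⊢
    linarith
  · rw [hper]
    exact hF.one_lt j hj t ht
  · rw [hper]
    exact hF.lt_one j hj t ht

end
end

section
/- Let q ≥ 1 and p ∈ ℤ, and let A : ℝ → ℝ be a continuous strictly increasing map with A(x+1) = A(x)+1 for all x and A^q(x) = x + p for all x. Define H : ℝ → ℝ by H(x) = (1/q) Σ_{i=0}^{q−1} (Aⁱ(x) − i·p/q). Then H is a continuous strictly increasing bijection of ℝ satisfying H(x+1) = H(x)+1 and H(A(x)) = H(x) + p/q for all x. Moreover, if A is real-analytic with A′(x) > 0 for all x, then H is real-analytic with H′(x) > 0 for all x. -/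
noncomputable section

/-- Iterates of a real-analytic map with positive derivative have the same properties. -/
theorem analyticAt_iterate_and_deriv_iterate_pos {A : ℝ → ℝ}
    (hA : ∀ x : ℝ, AnalyticAt ℝ A x) (hd : ∀ x : ℝ, 0 < deriv A x) (n : ℕ) :
    ∀ x : ℝ, AnalyticAt ℝ A^[n] x ∧ 0 < deriv A^[n] x := by
  induction n with
  | zero =>
    intro x
    rw [Function.iterate_zero]
    exact ⟨analyticAt_id, by simp⟩
  | succ n ih =>
    intro x
    rw [Function.iterate_succ]
    refine ⟨(ih (A x)).1.comp (hA x), ?_⟩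
    rw [deriv_comp x (ih (A x)).1.differentiableAt (hA x).differentiableAt]
    exact mul_pos (ih (A x)).2 (hd x)

/-- A continuous lift of a degree one monotone circle map is surjective. -/
theorem surjective_of_continuous_of_map_add_one {f : ℝ → ℝ} (hc : Continuous f)
    (hm : Monotone f) (h1 : ∀ x : ℝ, f (x + 1) = f x + 1) : Function.Surjective f :=
  let F : CircleDeg1Lift := ⟨⟨f, hm⟩, h1⟩
  hc.surjective F.tendsto_atTop F.tendsto_atBot

/-- Averaging a lift of a finite-order circle map: if `A` is a continuous strictly
increasing map with `A(x+1) = A(x)+1` and `A^q(x) = x + p`, then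
`H(x) = (1/q) Σ_{i<q} (Aⁱ(x) - i·p/q)` is a continuous strictly increasing bijection
of `ℝ` commuting with integer translations and conjugating `A` to the translation by
`p/q`; moreover `H` is real-analytic with positive derivative whenever `A` is. -/
theorem conjugation_of_finite_order_lift
    (q : ℕ) (hq : 1 ≤ q) (p : ℤ) (A : ℝ → ℝ)
    (hAc : Continuous A) (hAm : StrictMono A)
    (hA1 : ∀ x : ℝ, A (x + 1) = A x + 1)
    (hAq : ∀ x : ℝ, A^[q] x = x + (p : ℝ)) :
    ∀ H : ℝ → ℝ,
      (∀ x : ℝ, H x = (1 / (q : ℝ)) *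
        ∑ i ∈ Finset.range q, (A^[i] x - (i : ℝ) * (p : ℝ) / (q : ℝ))) →
      Continuous H ∧ StrictMono H ∧ Function.Bijective H ∧
        (∀ x : ℝ, H (x + 1) = H x + 1) ∧
        (∀ x : ℝ, H (A x) = H x + (p : ℝ) / (q : ℝ)) ∧
        (((∀ x : ℝ, AnalyticAt ℝ A x) ∧ ∀ x : ℝ, 0 < deriv A x) →
          (∀ x : ℝ, AnalyticAt ℝ H x) ∧ ∀ x : ℝ, 0 < deriv H x) := by
  intro H hH
  have hq0 : (0 : ℝ) < q := by exact_mod_cast hq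
  obtain rfl : H = fun x => (1 / (q : ℝ)) *
      ∑ i ∈ Finset.range q, (A^[i] x - (i : ℝ) * (p : ℝ) / (q : ℝ)) := funext hH
  clear hH
  have hne : (Finset.range q).Nonempty := Finset.nonempty_range_iff.2 (by omega)
  have hiter : ∀ (i : ℕ) (x : ℝ), A^[i] (x + 1) = A^[i] x + 1 := fun i =>
    Function.Commute.iterate_left (f := A) (g := fun x : ℝ => x + 1) hA1 i
  have hcont : Continuous fun x => (1 / (q : ℝ)) *
      ∑ i ∈ Finset.range q, (A^[i] x - (i : ℝ) * (p : ℝ) / (q : ℝ)) :=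
    continuous_const.mul
      (continuous_finsetSum _ fun i _ => (hAc.iterate i).sub continuous_const)
  have hmono : StrictMono fun x => (1 / (q : ℝ)) *
      ∑ i ∈ Finset.range q, (A^[i] x - (i : ℝ) * (p : ℝ) / (q : ℝ)) := fun x y hxy =>
    mul_lt_mul_of_pos_left
      (Finset.sum_lt_sum_of_nonempty hne fun i _ =>
        sub_lt_sub_right (hAm.iterate i hxy) _) (by positivity)
  have hadd : ∀ x : ℝ, (1 / (q : ℝ)) *
      ∑ i ∈ Finset.range q, (A^[i] (x + 1) - (i : ℝ) * (p : ℝ) / (q : ℝ)) =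
      (1 / (q : ℝ)) *
        ∑ i ∈ Finset.range q, (A^[i] x - (i : ℝ) * (p : ℝ) / (q : ℝ)) + 1 := by
    intro x
    simp only [hiter, Finset.sum_sub_distrib, Finset.sum_add_distrib, Finset.sum_const,
      Finset.card_range, nsmul_eq_mul]
    rw [add_sub_right_comm, mul_add, mul_one, one_div_mul_cancel hq0.ne']
  refine ⟨hcont, hmono, ⟨hmono.injective,
    surjective_of_continuous_of_map_add_one hcont hmono.monotone hadd⟩, hadd, ?_, ?_⟩
  · intro x
    have htel : ∑ i ∈ Finset.range q, A^[i] (A x) =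
        ∑ i ∈ Finset.range q, A^[i] x + p := by
      have h := Finset.sum_range_succ' (fun i => A^[i] x) q
      rw [Finset.sum_range_succ, hAq] at h
      simp only [Function.iterate_succ_apply, Function.iterate_zero_apply] at h
      linarith
    simp only [Finset.sum_sub_distrib, htel]
    ring
  · rintro ⟨hA, hd⟩
    have hit := analyticAt_iterate_and_deriv_iterate_pos hA hd
    refine ⟨fun x => analyticAt_const.mul (Finset.analyticAt_fun_sum _ fun i _ =>
      (hit i x).1.sub analyticAt_const), fun x => ?_⟩
    have hder : HasDerivAt (fun x => (1 / (q : ℝ)) *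
        ∑ i ∈ Finset.range q, (A^[i] x - (i : ℝ) * (p : ℝ) / (q : ℝ)))
        ((1 / (q : ℝ)) * ∑ i ∈ Finset.range q, deriv A^[i] x) x :=
      (HasDerivAt.fun_sum fun i _ =>
        (hit i x).1.differentiableAt.hasDerivAt.sub_const _).const_mul _
    rw [hder.deriv]
    exact mul_pos (by positivity) (Finset.sum_pos (fun i _ => (hit i x).2) hne)

end
end
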